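/- arXiv:1407.4567 — 2 statements merged into one kernel-verified Lean document; each statement's English description precedes it below -/
import Mathlib

section
/- Let K be an algebraically closed field of odd characteristic, let f ∈ K[X] be an additive polynomial with f'(0) ≠ 0, and set F(X) := X·f(X). For every nonzero critical value γ of F (i.e. every nonzero γ of the form F(α) with F'(α) = 0), the polynomial F(X) − γ has exactly two roots of multiplicity 2 in K, and all of its other roots have multiplicity 1. -/
open Polynomial

/-- A polynomial `f ∈ K[X]` is additive if `f(X+Y) = f(X) + f(Y)` holds as an identity
of polynomials in two variables over `K`. -/
def IsAdditive {K : Type*} [CommSemiring K] (f : Polynomial K) : Prop :=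
    Polynomial.aeval ((Polynomial.C Polynomial.X + Polynomial.X : Polynomial (Polynomial K))) f =
      Polynomial.aeval ((Polynomial.C Polynomial.X : Polynomial (Polynomial K))) f +
        Polynomial.aeval ((Polynomial.X : Polynomial (Polynomial K))) f

namespace IsAdditive

variable {K : Type*}

theorem comp_C_add_X [CommSemiring K] {f : K[X]} (hf : IsAdditive f) (x : K) :
    f.comp (C x + X) = C (eval x f) + f := by
  have h := congrArg (mapAlgHom (aeval x : K[X] →ₐ[K] K)) hf
  simp only [map_add, ← aeval_algHom_apply] at h
  have hC : aeval (C x) f = C (eval x f) := aeval_algebraMap_apply_eq_algebraMap_eval x f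
  simpa [comp_eq_aeval, aeval_X_left_apply, hC] using h

theorem eval_add [CommSemiring K] {f : K[X]} (hf : IsAdditive f) (x y : K) :
    eval (x + y) f = eval x f + eval y f := by
  simpa using congrArg (eval y) (hf.comp_C_add_X x)

theorem eval_neg [CommRing K] {f : K[X]} (hf : IsAdditive f) (x : K) :
    eval (-x) f = -eval x f := by
  have h₀ := hf.eval_add 0 0
  have h := hf.eval_add x (-x)
  simp only [add_zero, left_eq_add, add_neg_cancel] at h₀ h
  linear_combination h₀ - h

theorem derivative_eq_C [CommRing K] [IsDomain K] [Infinite K] {f : K[X]} (hf : IsAdditive f) :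
    derivative f = C (eval 0 (derivative f)) := by
  refine Polynomial.funext fun x => ?_
  have h := congrArg (fun q => eval 0 (derivative q)) (hf.comp_C_add_X x)
  simpa [derivative_comp] using h

end IsAdditive

theorem Polynomial.rootMultiplicity_le_two {R : Type*} [CommRing R] {P : R[X]} {x : R}
    (h : eval x (derivative (derivative P)) ≠ 0) : P.rootMultiplicity x ≤ 2 := by
  by_contra! hlt
  obtain ⟨q, hq⟩ := (pow_dvd_pow (X - C x) hlt).trans (pow_rootMultiplicity_dvd P x)
  apply h
  simp [hq, derivative_mul, derivative_pow]

/-- Let `F := X·f(X)` with `f` additive, `f'(0) ≠ 0`, over an algebraically closed field of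
odd characteristic.  For every nonzero critical value `γ` of `F`, the polynomial `F - γ`
has exactly two roots of multiplicity `2`, and all of its other roots have multiplicity `1`. -/
theorem statement7 {K : Type*} [Field K] [IsAlgClosed K] (p : ℕ) [CharP K p] (hp : Odd p)
    (f : K[X]) (hf : IsAdditive f) (hf0 : eval 0 (derivative f) ≠ 0)
    (γ : K) (hγ : γ ≠ 0)
    (hcrit : ∃ α : K, eval α (derivative (X * f)) = 0 ∧ eval α (X * f) = γ) :
    {x : K | (X * f - C γ).rootMultiplicity x = 2}.ncard = 2 ∧
      ∀ x : K, eval x (X * f - C γ) = 0 →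
        (X * f - C γ).rootMultiplicity x = 2 ∨ (X * f - C γ).rootMultiplicity x = 1 := by
  have h2 : (2 : K) ≠ 0 := by
    intro h
    have hdvd : p ∣ 2 := (CharP.cast_eq_zero_iff K p 2).mp (by exact_mod_cast h)
    rcases (Nat.dvd_prime Nat.prime_two).mp hdvd with rfl | rfl
    · exact CharP.char_ne_one K 1 rfl
    · exact absurd hp (by decide)
  have hd := hf.derivative_eq_C
  generalize eval 0 (derivative f) = a at hd hf0
  set P := X * f - C γ with hP
  have hP' : derivative P = f + C a * X := by
    rw [hP, derivative_sub, derivative_mul, hd, derivative_X, derivative_C]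
    ring
  have hP'' (x : K) : eval x (derivative (derivative P)) ≠ 0 := by
    rw [hP']
    simpa [hd, ← two_mul] using ⟨h2, hf0⟩
  have hP0 : P ≠ 0 := fun h => hP'' 0 (by simp [h])
  have hle (x : K) : P.rootMultiplicity x ≤ 2 := rootMultiplicity_le_two (hP'' x)
  have hiff (x : K) : P.rootMultiplicity x = 2 ↔
      eval x f = -(a * x) ∧ x * eval x f = γ := by
    have h : 1 < P.rootMultiplicity x ↔ _ := one_lt_rootMultiplicity_iff_isRoot hP0
    rw [hP'] at h
    simp only [IsRoot, hP, eval_sub, eval_mul, eval_X, eval_C, eval_add, sub_eq_zero,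
      add_eq_zero_iff_eq_neg] at h
    rw [← hP] at h
    rw [and_comm, ← h]
    have := hle x
    omega
  refine ⟨?_, fun x hx => ?_⟩
  · obtain ⟨α, hα, hαγ⟩ := hcrit
    have hfα : eval α f = -(a * α) := by
      simp [hd] at hα
      linear_combination hα
    simp only [eval_mul, eval_X] at hαγ
    have hα0 : α ≠ 0 := by
      rintro rfl
      exact hγ (by simpa using hαγ.symm)
    have hset : {x : K | P.rootMultiplicity x = 2} = {α, -α} := by
      ext x
      simp only [Set.mem_ofPred_eq, hiff, Set.mem_insert_iff, Set.mem_singleton_iff]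
      constructor
      · rintro ⟨h₁, h₂⟩
        rw [← sq_eq_sq_iff_eq_or_eq_neg]
        rw [h₁] at h₂
        rw [hfα] at hαγ
        exact mul_left_cancel₀ hf0 (by linear_combination hαγ - h₂)
      · rintro (rfl | rfl)
        · exact ⟨hfα, hαγ⟩
        · rw [hf.eval_neg]
          exact ⟨by rw [hfα]; ring, by rw [← hαγ]; ring⟩
    rw [hset, Set.ncard_pair]
    intro h
    exact mul_ne_zero h2 hα0 (by linear_combination h)
  · have hpos := (rootMultiplicity_pos hP0).mpr hx
    have := hle x
    omega
end

section
/- Let K be an algebraically closed field of odd characteristic, let f ∈ K[X] be an additive polynomial with f'(0) ≠ 0, set F(X) := X·f(X), and write F = A ∘ X² with A ∈ K[X]. Then the critical values of A (the elements A(α) with A'(α) = 0) are precisely the nonzero critical values of F, and for each such value γ the polynomial A(X) − γ has exactly one root of multiplicity 2 in K and all other roots of multiplicity 1. -/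
open Polynomial

theorem IsAdditive.derivative_eq_C_s9 {K : Type*} [Field K] [Infinite K] {f : K[X]}
    (hf : IsAdditive f) : derivative f = C (eval 0 (derivative f)) := by
  refine Polynomial.funext fun a => ?_
  have h := congrArg (mapRingHom (evalRingHom a)) hf
  have h' : f.comp (C a + X) = C (eval a f) + f := by
    simp only [aeval_def, map_add, hom_eval₂] at h
    have e : ((mapRingHom (evalRingHom a)).comp (algebraMap K K[X][X])) = (C : K →+* K[X]) := by
      ext x
      simp [Polynomial.algebraMap_apply]
    rw [e] at h
    simpa [eval₂_C_X, comp, ← hom_eval₂, eval₂_at_apply] using h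
  have h'' := congrArg (fun g => eval 0 (derivative g)) h'
  simpa [derivative_comp] using h''

theorem Polynomial.rootMultiplicity_eq_one_of_derivative_ne_zero {R : Type*} [CommRing R]
    {P : R[X]} {a : R} (h0 : eval a P = 0) (h1 : eval a (derivative P) ≠ 0) :
    P.rootMultiplicity a = 1 := by
  have hP : P ≠ 0 := by
    rintro rfl
    simp at h1
  have hpos := (rootMultiplicity_pos hP).2 h0
  by_contra hne
  exact h1 (isRoot_iterate_derivative_of_lt_rootMultiplicity (n := 1) (by omega))

theorem Polynomial.rootMultiplicity_eq_two_of_derivative_ne_zero {R : Type*} [CommRing R]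
    {P : R[X]} {a : R} (h0 : eval a P = 0) (h1 : eval a (derivative P) = 0)
    (h2 : eval a (derivative (derivative P)) ≠ 0) : P.rootMultiplicity a = 2 := by
  have hP : P ≠ 0 := by
    rintro rfl
    simp at h2
  have hlt := (one_lt_rootMultiplicity_iff_isRoot hP).2 ⟨h0, h1⟩
  by_contra hne
  exact h2 (isRoot_iterate_derivative_of_lt_rootMultiplicity (n := 2) (by omega))

/-- Let `F := X·f(X)` with `f` additive, `f'(0) ≠ 0`, over an algebraically closed field of
odd characteristic, and write `F = A ∘ X²`.  Then the critical values of `A` are precisely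
the nonzero critical values of `F`, and for each such value `γ` the polynomial `A - γ` has
exactly one root of multiplicity `2` and all other roots of multiplicity `1`. -/
theorem statement9 {K : Type*} [Field K] [IsAlgClosed K] (p : ℕ) [CharP K p] (hp : Odd p)
    (f : K[X]) (hf : IsAdditive f) (hf0 : eval 0 (derivative f) ≠ 0)
    (A : K[X]) (hA : X * f = A.comp (X ^ 2)) :
    ({γ : K | ∃ α : K, eval α (derivative A) = 0 ∧ eval α A = γ} =
        {γ : K | γ ≠ 0 ∧ ∃ α : K, eval α (derivative (X * f)) = 0 ∧ eval α (X * f) = γ}) ∧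
      ∀ γ : K, (∃ α : K, eval α (derivative A) = 0 ∧ eval α A = γ) →
        ({x : K | (A - C γ).rootMultiplicity x = 2}.ncard = 1 ∧
          ∀ x : K, eval x (A - C γ) = 0 →
            (A - C γ).rootMultiplicity x = 2 ∨ (A - C γ).rootMultiplicity x = 1) := by
  have two_ne : (2 : K) ≠ 0 := by
    refine Ring.two_ne_zero ?_
    rw [ringChar.eq K p]
    rintro rfl
    exact absurd hp (by decide)
  have hd := hf.derivative_eq_C_s9
  set c := eval 0 (derivative f) with hc
  have hF (x : K) : x * eval x f = eval (x ^ 2) A := by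
    simpa using congrArg (eval x) hA
  have hF' (x : K) : eval x f + c * x = 2 * x * eval (x ^ 2) (derivative A) := by
    have h := congrArg (fun g => eval x (derivative g)) hA
    simp [derivative_comp, hd] at h
    linear_combination h
  have hF'' (x : K) : c = eval (x ^ 2) (derivative A)
      + 2 * x ^ 2 * eval (x ^ 2) (derivative (derivative A)) := by
    have h := congrArg (fun g => eval x (derivative (derivative g))) hA
    simp [derivative_comp, hd] at h
    refine mul_left_cancel₀ two_ne ?_
    linear_combination h
  have crit {α : K} (h : eval α (derivative A) = 0) :
      α ≠ 0 ∧ eval α (derivative (derivative A)) ≠ 0 ∧ eval α A = -c * α := by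
    obtain ⟨x, rfl⟩ := IsAlgClosed.exists_pow_nat_eq α (n := 2) (by norm_num)
    have h1 := hF' x
    have h2 := hF'' x
    rw [h] at h1 h2
    refine ⟨fun h3 => hf0 ?_, fun h3 => hf0 ?_, ?_⟩
    · rw [h2, h3]
      ring
    · rw [h2, h3]
      ring
    · linear_combination x * h1 - hF x
  refine ⟨Set.ext fun γ => ⟨?_, ?_⟩, ?_⟩
  · rintro ⟨α, h, rfl⟩
    obtain ⟨hα, -, hv⟩ := crit h
    refine ⟨hv ▸ mul_ne_zero (neg_ne_zero.2 hf0) hα, ?_⟩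
    obtain ⟨x, rfl⟩ := IsAlgClosed.exists_pow_nat_eq α (n := 2) (by norm_num)
    refine ⟨x, ?_, by simpa using hF x⟩
    simp [hA, derivative_comp, h]
  · rintro ⟨hγ, x, h, rfl⟩
    refine ⟨x ^ 2, ?_, by simp [hA]⟩
    have hx : x ≠ 0 := by
      rintro rfl
      simp at hγ
    simpa [hA, derivative_comp, hx, two_ne, one_add_one_eq_two] using h
  · rintro γ ⟨α, h, rfl⟩
    have hα : (A - C (eval α A)).rootMultiplicity α = 2 :=
      rootMultiplicity_eq_two_of_derivative_ne_zero (by simp) (by simpa using h)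
        (by simpa using (crit h).2.1)
    have key (x : K) (hx : eval x (A - C (eval α A)) = 0) (hne : x ≠ α) :
        (A - C (eval α A)).rootMultiplicity x = 1 := by
      refine rootMultiplicity_eq_one_of_derivative_ne_zero hx fun h' => hne ?_
      have hx' : eval x (derivative A) = 0 := by simpa using h'
      refine mul_left_cancel₀ (neg_ne_zero.2 hf0) ?_
      rw [← (crit hx').2.2, ← (crit h).2.2]
      simpa [sub_eq_zero] using hx
    refine ⟨Set.ncard_eq_one.2 ⟨α, Set.ext fun x => ⟨fun hx => ?_, ?_⟩⟩, fun x hx => ?_⟩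
    · by_contra hne
      have hx2 : (A - C (eval α A)).rootMultiplicity x = 2 := hx
      have hr : eval x (A - C (eval α A)) = 0 := by
        by_contra hr
        have := rootMultiplicity_eq_zero hr
        omega
      have := key x hr hne
      omega
    · rintro rfl
      exact hα
    · rcases eq_or_ne x α with rfl | hne
      · exact Or.inl hα
      · exact Or.inr (key x hx hne)
end
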